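/- arXiv:math/0703340 — 3 statements merged into one kernel-verified Lean document; each statement's English description precedes it below -/
import Mathlib

section
/- If a > a* (where a* = 4π e^{-γ}), then there is exactly one ρ_a ∈ (1/2, 1) with φ₀(a, ρ_a) = 0; moreover φ₀(a, 1-ρ_a) = 0, both ρ_a and 1-ρ_a are simple zeros (the s-derivative of φ₀(a,·) is nonzero there), and every zero s ∉ {0, 1/2, 1} of φ₀(a,·) with Re(s) ≠ 1/2 belongs to {ρ_a, 1-ρ_a}. -/
open Complex

/-- The constant term `φ₀(a,s) = Λ(2s) a^s + Λ(2s-1) a^{1-s}` of the completed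
nonholomorphic Eisenstein series for the modular group, where `Λ` is the completed
Riemann zeta function. -/
noncomputable def phi0 (a : ℝ) (s : ℂ) : ℂ :=
  completedRiemannZeta (2 * s) * (a : ℂ) ^ s +
    completedRiemannZeta (2 * s - 1) * (a : ℂ) ^ (1 - s)

/-- The critical value `a* = 4 π e^{-γ}`, where `γ` is the Euler–Mascheroni constant. -/
noncomputable def aStar : ℝ := 4 * Real.pi * Real.exp (-Real.eulerMascheroniConstant)

open MeasureTheory Set Filter Asymptotics Topology in
/-- The Mellin transform at `-s` of the fractional part restricted to `(1, ∞)` is holomorphic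
on `0 < re s`. -/
lemma differentiableAt_mellin_fract {s : ℂ} (hs : 0 < s.re) :
    DifferentiableAt ℂ (fun s ↦ mellin
      ((Ioi (1 : ℝ)).indicator fun t ↦ ((Int.fract t : ℝ) : ℂ)) (-s)) s := by
  have hm : Measurable ((Ioi (1 : ℝ)).indicator fun t ↦ ((Int.fract t : ℝ) : ℂ)) :=
    (Complex.measurable_ofReal.comp measurable_fract).indicator measurableSet_Ioi
  have hb : ∀ t : ℝ, ‖(Ioi (1 : ℝ)).indicator (fun t ↦ ((Int.fract t : ℝ) : ℂ)) t‖ ≤ 1 := by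
    intro t
    refine (norm_indicator_le_norm_self _ _).trans ?_
    rw [Complex.norm_real, Real.norm_of_nonneg (Int.fract_nonneg t)]
    exact (Int.fract_lt_one t).le
  have key := mellin_differentiableAt_of_isBigO_rpow (a := 0) (b := (-s).re - 1) (s := -s)
    (f := (Ioi (1 : ℝ)).indicator fun t ↦ ((Int.fract t : ℝ) : ℂ)) ?_ ?_ (by simpa) ?_ (by simp)
  · exact key.comp s differentiableAt_id.neg
  · exact ((locallyIntegrable_const (1 : ℝ)).mono hm.aestronglyMeasurable
      (by filter_upwards with t; simpa using hb t)).locallyIntegrableOn _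
  · exact isBigO_of_le' (c := 1) _ fun t ↦ by simpa using hb t
  · refine IsBigO.of_bound 0 ?_
    filter_upwards [Ioo_mem_nhdsGT (zero_lt_one (α := ℝ))] with t ht
    simp [indicator_of_notMem (show t ∉ Ioi 1 from not_lt.2 ht.2.le)]

open MeasureTheory Set in
lemma mellin_fract_eq_integral (s : ℂ) :
    mellin ((Ioi (1 : ℝ)).indicator fun t ↦ ((Int.fract t : ℝ) : ℂ)) (-s) =
      ∫ t in Ioi (1 : ℝ), ((Int.fract t : ℝ) : ℂ) * (t : ℂ) ^ (-(s + 1)) := by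
  have : ∀ t : ℝ, (t : ℂ) ^ (-s - 1) •
      (Ioi (1 : ℝ)).indicator (fun t ↦ ((Int.fract t : ℝ) : ℂ)) t =
      (Ioi (1 : ℝ)).indicator (fun t ↦ ((Int.fract t : ℝ) : ℂ) * (t : ℂ) ^ (-(s + 1))) t := by
    intro t
    by_cases ht : t ∈ Ioi (1 : ℝ)
    · simp only [indicator_of_mem ht, smul_eq_mul]
      rw [mul_comm, neg_add']
    · simp only [indicator_of_notMem ht, smul_zero]
  simp_rw [mellin, this]
  rw [setIntegral_indicator measurableSet_Ioi, inter_eq_right.2 (Ioi_subset_Ioi zero_le_one)]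

open MeasureTheory Set in
lemma norm_mellin_fract_le {s : ℂ} (hs : 0 < s.re) :
    ‖mellin ((Ioi (1 : ℝ)).indicator fun t ↦ ((Int.fract t : ℝ) : ℂ)) (-s)‖ ≤ 1 / s.re := by
  rw [mellin_fract_eq_integral]
  have hi := integral_Ioi_rpow_of_lt (a := -(s.re + 1)) (c := 1) (by linarith) one_pos
  have : ∫ t in Ioi (1 : ℝ), t ^ (-(s.re + 1)) = 1 / s.re := by
    rw [hi, Real.one_rpow, show -(s.re + 1) + 1 = -s.re by ring, neg_div_neg_eq]
  rw [← this]
  refine norm_integral_le_of_norm_le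
    (integrableOn_Ioi_rpow_of_lt (by linarith) one_pos) ?_
  refine (ae_restrict_iff' measurableSet_Ioi).2 (Filter.Eventually.of_forall fun t ht ↦ ?_)
  have h0 : (0 : ℝ) < t := one_pos.trans ht
  rw [norm_mul, Complex.norm_real, Real.norm_of_nonneg (Int.fract_nonneg t),
    Complex.norm_cpow_eq_rpow_re_of_pos h0]
  simp only [neg_re, add_re, one_re]
  exact mul_le_of_le_one_left (by positivity) (Int.fract_lt_one t).le

open MeasureTheory Set in
lemma riemannZeta₁_eq_of_one_lt_re {s : ℂ} (hs : 1 < s.re) :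
    riemannZeta₁ s = s - s * (s - 1) *
      mellin ((Ioi (1 : ℝ)).indicator fun t ↦ ((Int.fract t : ℝ) : ℂ)) (-s) := by
  have hs1 : s ≠ 1 := by rintro rfl; simp at hs
  have hs1' : s - 1 ≠ 0 := sub_ne_zero.2 hs1
  have hL : riemannZeta s = s * ∫ t in Ioi (1 : ℝ), ((⌊t⌋₊ : ℕ) : ℂ) * (t : ℂ) ^ (-(s + 1)) := by
    rw [← LSeries_one_eq_riemannZeta hs,
      LSeries_eq_mul_integral' 1 zero_le_one hs (Asymptotics.isBigO_of_le _ fun n ↦ by simp)]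
    simp
  have hz : riemannZeta₁ s = (s - 1) * riemannZeta s := by
    rw [riemannZeta_eq_inv_sub_mul hs1, mul_inv_cancel_left₀ hs1']
  have hint : ∫ t in Ioi (1 : ℝ), (t : ℂ) ^ (-s) = 1 / (s - 1) := by
    rw [integral_Ioi_cpow_of_lt (by simpa) one_pos]
    rw [ofReal_one, one_cpow, show -s + 1 = -(s - 1) by ring, neg_div_neg_eq]
  have hI1 : IntegrableOn (fun t : ℝ ↦ (t : ℂ) ^ (-s)) (Ioi 1) :=
    integrableOn_Ioi_cpow_of_lt (by simpa) one_pos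
  have hI2 : IntegrableOn (fun t : ℝ ↦ ((Int.fract t : ℝ) : ℂ) * (t : ℂ) ^ (-(s + 1))) (Ioi 1) := by
    refine (integrableOn_Ioi_cpow_of_lt (a := -(s + 1)) (by simp; linarith) one_pos).bdd_mul
      (c := 1) (Complex.measurable_ofReal.comp measurable_fract).aestronglyMeasurable ?_
    filter_upwards with t
    simp only [Complex.norm_real, Real.norm_of_nonneg (Int.fract_nonneg t)]
    exact (Int.fract_lt_one t).le
  have hsplit : ∫ t in Ioi (1 : ℝ), ((⌊t⌋₊ : ℕ) : ℂ) * (t : ℂ) ^ (-(s + 1)) =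
      (∫ t in Ioi (1 : ℝ), (t : ℂ) ^ (-s)) -
        ∫ t in Ioi (1 : ℝ), ((Int.fract t : ℝ) : ℂ) * (t : ℂ) ^ (-(s + 1)) := by
    rw [← integral_sub hI1 hI2]
    refine setIntegral_congr_fun measurableSet_Ioi fun t ht ↦ ?_
    have h0 : (0 : ℝ) < t := one_pos.trans ht
    have hf : ((⌊t⌋₊ : ℕ) : ℂ) = t - ((Int.fract t : ℝ) : ℂ) := by
      rw [← ofReal_natCast, ← ofReal_sub, natCast_floor_eq_intCast_floor h0.le, Int.self_sub_fract]
    have ht' : (t : ℂ) ^ (-s) = t * (t : ℂ) ^ (-(s + 1)) := by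
      nth_rw 2 [← cpow_one (t : ℂ)]
      rw [← cpow_add _ _ (ofReal_ne_zero.2 h0.ne')]; congr 1; ring
    simp only [hf, ht']; ring
  rw [hz, hL, hsplit, hint, mellin_fract_eq_integral]
  field_simp

open Set in
lemma riemannZeta₁_eq_of_re_pos {s : ℂ} (hs : 0 < s.re) :
    riemannZeta₁ s = s - s * (s - 1) *
      mellin ((Ioi (1 : ℝ)).indicator fun t ↦ ((Int.fract t : ℝ) : ℂ)) (-s) := by
  have hU : IsOpen {s : ℂ | 0 < s.re} := isOpen_lt continuous_const continuous_re
  have hV : IsOpen {s : ℂ | 1 < s.re} := isOpen_lt continuous_const continuous_re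
  have hR : DifferentiableOn ℂ (fun s ↦ s - s * (s - 1) *
      mellin ((Ioi (1 : ℝ)).indicator fun t ↦ ((Int.fract t : ℝ) : ℂ)) (-s)) {s : ℂ | 0 < s.re} :=
    fun s hs ↦ ((differentiableAt_id).sub ((differentiableAt_id.mul
      (differentiableAt_id.sub_const 1)).mul
        (differentiableAt_mellin_fract hs))).differentiableWithinAt
  have hL := differentiable_riemannZeta₁.differentiableOn.analyticOnNhd hU
  refine hL.eqOn_of_preconnected_of_eventuallyEq
    (hR.analyticOnNhd hU) (convex_halfSpace_re_gt 0).isPreconnected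
    (z₀ := 2) (by simp) ?_ hs
  filter_upwards [hV.mem_nhds (show (2 : ℂ) ∈ {s : ℂ | 1 < s.re} by simp)] with z hz
  exact riemannZeta₁_eq_of_one_lt_re hz

lemma norm_riemannZeta₁_le {s : ℂ} (hs : 0 < s.re) :
    ‖riemannZeta₁ s‖ ≤ ‖s‖ + ‖s‖ * ‖s - 1‖ / s.re := by
  rw [riemannZeta₁_eq_of_re_pos hs]
  refine (norm_sub_le _ _).trans ?_
  gcongr
  rw [norm_mul, norm_mul, div_eq_mul_one_div]
  gcongr
  exact norm_mellin_fract_le hs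

lemma norm_riemannZeta_ofReal_le {x : ℝ} (hx : 1 < x) :
    ‖riemannZeta x‖ ≤ (2 * x - 1) / (x - 1) := by
  have h := norm_riemannZeta₁_le (s := x) (by simp; linarith)
  have h1 : (x : ℂ) ≠ 1 := by exact_mod_cast hx.ne'
  rw [riemannZeta_eq_inv_sub_mul h1, norm_mul, norm_inv]
  have h2 : ‖(x : ℂ) - 1‖ = x - 1 := by
    rw [← ofReal_one, ← ofReal_sub, Complex.norm_of_nonneg (by linarith)]
  have h3 : ‖(x : ℂ)‖ = x := Complex.norm_of_nonneg (by linarith)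
  rw [h2, h3, ofReal_re] at h
  rw [h2, div_eq_inv_mul]
  have : 0 < x - 1 := by linarith
  gcongr
  refine h.trans_eq ?_
  field_simp
  ring

open ArithmeticFunction in
lemma norm_inv_riemannZeta_le {s : ℂ} (hs : 1 < s.re) :
    ‖(riemannZeta s)⁻¹‖ ≤ (2 * s.re - 1) / (s.re - 1) := by
  have hμ : (riemannZeta s)⁻¹ = LSeries (fun n ↦ (moebius n : ℂ)) s := by
    rw [← LSeries_one_eq_riemannZeta hs]
    exact inv_eq_of_mul_eq_one_right (LSeries_one_mul_Lseries_moebius hs)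
  refine le_trans ?_ (norm_riemannZeta_ofReal_le hs)
  rw [hμ, ← LSeries_one_eq_riemannZeta (by simpa), LSeries, LSeries]
  have hterm : ∀ n, LSeries.term 1 (s.re : ℂ) n = (‖LSeries.term 1 s n‖ : ℂ) := by
    intro n
    rcases eq_or_ne n 0 with rfl | hn
    · simp
    · rw [LSeries.norm_term_eq, LSeries.term_of_ne_zero hn]
      simp [hn, ofReal_cpow]
  have hsum : Summable fun n ↦ ‖LSeries.term 1 s n‖ := (LSeriesSummable_one_iff.2 hs).norm
  simp_rw [hterm]
  rw [← ofReal_tsum, Complex.norm_of_nonneg (tsum_nonneg fun _ ↦ norm_nonneg _)]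
  refine tsum_of_norm_bounded hsum.hasSum fun n ↦ LSeries.norm_term_le s ?_
  rw [Complex.norm_intCast]
  simpa using mod_cast abs_moebius_le_one

open MeasureTheory Set in
lemma norm_betaIntegral_half_le {w : ℂ} (hw : 1 ≤ w.re) : ‖betaIntegral w (1 / 2)‖ ≤ 2 := by
  have hI : ∫ x in (0 : ℝ)..1, (1 - x) ^ (-(1 / 2) : ℝ) = 2 := by
    rw [intervalIntegral.integral_comp_sub_left (fun x : ℝ ↦ x ^ (-(1 / 2) : ℝ)),
      integral_rpow (by norm_num)]
    norm_num
  have hint : IntervalIntegrable (fun x : ℝ ↦ (1 - x) ^ (-(1 / 2) : ℝ)) volume 0 1 := by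
    have := (intervalIntegral.intervalIntegrable_rpow' (r := -(1 / 2)) (a := 0) (b := 1)
      (by norm_num)).comp_sub_left 1
    simpa using this.symm
  rw [← hI, betaIntegral]
  refine intervalIntegral.norm_integral_le_of_norm_le zero_le_one ?_ hint
  filter_upwards [compl_mem_ae_iff.2 (measure_singleton (1 : ℝ))] with x hx1 hx
  have hx0 : 0 < x := hx.1
  have hx1 : 0 < 1 - x := sub_pos.2 (lt_of_le_of_ne hx.2 hx1)
  rw [norm_mul, norm_cpow_eq_rpow_re_of_pos hx0, ← ofReal_one, ← ofReal_sub,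
    norm_cpow_eq_rpow_re_of_pos hx1]
  have : ((1 / 2 : ℂ) - (1 : ℝ)).re = -(1 / 2) := by norm_num
  rw [ofReal_one] at *
  rw [this]
  exact mul_le_of_le_one_left (by positivity)
    (Real.rpow_le_one hx0.le hx.2 (by simpa using hw))

/-- The entire function `s (s - 1) Λ(s)`, i.e. twice Riemann's `ξ`. -/
noncomputable def xi (s : ℂ) : ℂ := s * (s - 1) * completedRiemannZeta₀ s + 1

lemma differentiable_xi : Differentiable ℂ xi :=
  ((differentiable_id.mul (differentiable_id.sub_const 1)).mul
    differentiable_completedZeta₀).add_const 1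

lemma xi_one_sub (s : ℂ) : xi (1 - s) = xi s := by
  simp only [xi, completedRiemannZeta₀_one_sub]; ring

@[simp] lemma xi_zero : xi 0 = 1 := by simp [xi]

@[simp] lemma xi_one : xi 1 = 1 := by simp [xi]

lemma xi_eq_mul_completedRiemannZeta {s : ℂ} (h0 : s ≠ 0) (h1 : s ≠ 1) :
    xi s = s * (s - 1) * completedRiemannZeta s := by
  have h1' : 1 - s ≠ 0 := sub_ne_zero.2 h1.symm
  rw [xi, completedRiemannZeta_eq]
  field_simp
  ring

lemma completedRiemannZeta_eq_mul {s : ℂ} (hs : 0 < s.re) :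
    completedRiemannZeta s = riemannZeta s * Gammaℝ s := by
  rw [riemannZeta_def_of_ne_zero (by rintro rfl; simp at hs),
    div_mul_cancel₀ _ (Gammaℝ_ne_zero_of_re_pos hs)]

lemma xi_ne_zero {s : ℂ} (hs : 1 ≤ s.re) : xi s ≠ 0 := by
  rcases eq_or_ne s 1 with rfl | h1
  · simp
  have h0 : s ≠ 0 := by rintro rfl; simp at hs; linarith
  rw [xi_eq_mul_completedRiemannZeta h0 h1, completedRiemannZeta_eq_mul (by linarith)]
  exact mul_ne_zero (mul_ne_zero h0 (sub_ne_zero.2 h1))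
    (mul_ne_zero (riemannZeta_ne_zero_of_one_le_re hs) (Gammaℝ_ne_zero_of_re_pos (by linarith)))

open ComplexConjugate

lemma Gammaℝ_conj (s : ℂ) : Gammaℝ (conj s) = conj (Gammaℝ s) := by
  have hπ : (Real.pi : ℂ).arg ≠ Real.pi := by
    rw [arg_ofReal_of_nonneg Real.pi_pos.le]; exact Real.pi_pos.ne
  have h := cpow_conj (Real.pi : ℂ) (-s / 2) hπ
  rw [conj_ofReal, map_div₀, map_neg, conj_ofNat] at h
  rw [Gammaℝ_def, Gammaℝ_def, map_mul, ← Gamma_conj, map_div₀, conj_ofNat, h]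

lemma xi_conj {s : ℂ} (hs : 0 < s.re) : xi (conj s) = conj (xi s) := by
  rcases eq_or_ne s 1 with rfl | h1
  · simp
  have h0 : s ≠ 0 := by rintro rfl; simp at hs
  have h0' : conj s ≠ 0 := by simpa
  have h1' : conj s ≠ 1 := by rwa [Ne, ← map_one conj, (starRingEnd ℂ).injective.eq_iff]
  rw [xi_eq_mul_completedRiemannZeta h0 h1, xi_eq_mul_completedRiemannZeta h0' h1',
    completedRiemannZeta_eq_mul hs, completedRiemannZeta_eq_mul (by simpa), Gammaℝ_conj,
    riemannZeta_conj]
  simp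

lemma norm_xi_add_one_of_re_eq_zero {u : ℂ} (hu : u.re = 0) : ‖xi (u + 1)‖ = ‖xi u‖ := by
  have : u + 1 = conj (1 - u) := by apply Complex.ext <;> simp [hu]
  rw [this, xi_conj (by simp [hu]), norm_conj, xi_one_sub]

lemma xi_div_xi_add_one {u : ℂ} (hu : 0 < u.re) :
    xi u / xi (u + 1) =
      riemannZeta₁ u / u * (riemannZeta (u + 1))⁻¹ * betaIntegral (u / 2 + 1) (1 / 2) := by
  have h0 : u ≠ 0 := by rintro rfl; simp at hu
  have h1 : u + 1 ≠ 0 := by intro h; have := congrArg re h; simp at this; linarith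
  have hζ : riemannZeta (u + 1) ≠ 0 := riemannZeta_ne_zero_of_one_le_re (by simp; linarith)
  have hξ : xi u = 2 * riemannZeta₁ u * (Real.pi : ℂ) ^ (-u / 2) * Gamma (u / 2 + 1) := by
    rcases eq_or_ne u 1 with rfl | hu1
    · rw [xi_one, riemannZeta₁_one, Gamma_add_one _ (by simp), Gamma_one_half_eq, neg_div, cpow_neg]
      have := cpow_ne_zero_iff_of_exponent_ne_zero (x := (Real.pi : ℂ)) (y := 1 / 2) (by simp)
      field_simp [this.2 (ofReal_ne_zero.2 Real.pi_ne_zero)]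
    rw [xi_eq_mul_completedRiemannZeta h0 hu1, completedRiemannZeta_eq_mul hu,
      riemannZeta_eq_inv_sub_mul hu1, Gamma_add_one _ (by simpa), Gammaℝ_def]
    have := sub_ne_zero.2 hu1
    field_simp
  have hξ' : xi (u + 1) = 2 * u * riemannZeta (u + 1) *
      (Real.pi : ℂ) ^ (-(u + 1) / 2) * Gamma (u / 2 + 1 + 1 / 2) := by
    rw [xi_eq_mul_completedRiemannZeta h1 (by simpa), completedRiemannZeta_eq_mul
      (by simp; linarith), show u / 2 + 1 + 1 / 2 = (u + 1) / 2 + 1 by ring,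
      Gamma_add_one _ (by simpa), Gammaℝ_def]
    ring
  have hβ := Gamma_mul_Gamma_eq_betaIntegral (s := u / 2 + 1) (t := 1 / 2)
    (by simp; linarith) (by norm_num)
  have hΓ : Gamma (u / 2 + 1 + 1 / 2) ≠ 0 := Gamma_ne_zero_of_re_pos (by simp; linarith)
  have hπ0 : (Real.pi : ℂ) ≠ 0 := ofReal_ne_zero.2 Real.pi_ne_zero
  have hπ : (Real.pi : ℂ) ^ (-u / 2) = (Real.pi : ℂ) ^ (-(u + 1) / 2) * Gamma (1 / 2) := by
    rw [Gamma_one_half_eq, ← cpow_add _ _ hπ0]; congr 1; ring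
  have hπ' : (Real.pi : ℂ) ^ (-(u + 1) / 2) ≠ 0 := by simp [cpow_eq_zero_iff, hπ0]
  rw [hξ, hξ', hπ]
  generalize Gamma (u / 2 + 1 + 1 / 2) = G at hβ hΓ ⊢
  generalize Gamma (u / 2 + 1) = G' at hβ ⊢
  generalize betaIntegral (u / 2 + 1) (1 / 2) = b at hβ ⊢
  field_simp
  linear_combination riemannZeta₁ u * hβ

lemma norm_xi_div_xi_add_one_le {u : ℂ} (hu : 0 < u.re) :
    ‖xi u / xi (u + 1)‖ ≤ 2 * ((2 * ‖u‖ + 1) / u.re) ^ 2 := by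
  have hle : u.re ≤ ‖u‖ := re_le_norm u
  have hn : 0 < ‖u‖ := hu.trans_le hle
  have h1 : ‖riemannZeta₁ u / u‖ ≤ (2 * ‖u‖ + 1) / u.re := by
    rw [norm_div, div_le_iff₀ hn]
    refine (norm_riemannZeta₁_le hu).trans ?_
    have : ‖u - 1‖ ≤ ‖u‖ + 1 := (norm_sub_le _ _).trans (by simp)
    calc ‖u‖ + ‖u‖ * ‖u - 1‖ / u.re ≤ ‖u‖ * (‖u‖ / u.re) + ‖u‖ * (‖u‖ + 1) / u.re := by
          gcongr
          exact le_mul_of_one_le_right hn.le ((one_le_div hu).2 hle)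
      _ = _ := by ring
  have h2 : ‖(riemannZeta (u + 1))⁻¹‖ ≤ (2 * ‖u‖ + 1) / u.re := by
    refine (norm_inv_riemannZeta_le (by simpa)).trans ?_
    simp only [add_re, one_re, add_sub_cancel_right]
    gcongr
    linarith
  have h3 := norm_betaIntegral_half_le (w := u / 2 + 1) (by simp; linarith)
  rw [xi_div_xi_add_one hu, norm_mul, norm_mul]
  calc _ ≤ (2 * ‖u‖ + 1) / u.re * ((2 * ‖u‖ + 1) / u.re) * 2 := by gcongr
    _ = _ := by ring

open Set in
lemma frontier_half_disc_subset (R : ℝ) :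
    frontier ({u : ℂ | 0 < u.re} ∩ Metric.ball 0 R) ⊆
      {u | u.re = 0 ∧ ‖u‖ ≤ R} ∪ {u | 0 < u.re ∧ ‖u‖ = R} := by
  have hU : IsOpen ({u : ℂ | 0 < u.re} ∩ Metric.ball 0 R) :=
    (isOpen_lt continuous_const continuous_re).inter Metric.isOpen_ball
  rintro u hu
  rw [hU.frontier_eq] at hu
  have hK : IsClosed ({u : ℂ | 0 ≤ u.re} ∩ Metric.closedBall 0 R) :=
    (isClosed_le continuous_const continuous_re).inter Metric.isClosed_closedBall
  have hc : u ∈ {u : ℂ | 0 ≤ u.re} ∩ Metric.closedBall 0 R :=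
    closure_minimal (inter_subset_inter (ofPred_subset_ofPred.2 fun _ h ↦ le_of_lt h)
      Metric.ball_subset_closedBall) hK hu.1
  have h1 : 0 ≤ u.re := hc.1
  have h2 : ‖u‖ ≤ R := by simpa using hc.2
  rcases h1.eq_or_lt with h | h
  · exact Or.inl ⟨h.symm, h2⟩
  · refine Or.inr ⟨h, h2.eq_or_lt.resolve_right fun h3 ↦ hu.2 ⟨h, by simpa using h3⟩⟩

/-- A Phragmén–Lindelöf principle on the right half-plane for functions of polynomial growth
with a controlled blow-up near the boundary. -/
lemma norm_le_one_of_re_pos_of_growth {h : ℂ → ℂ} {C : ℝ}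
    (hd : ∀ u : ℂ, 0 ≤ u.re → DifferentiableAt ℂ h u) (hb : ∀ u : ℂ, u.re = 0 → ‖h u‖ ≤ 1)
    (hg : ∀ u : ℂ, 0 < u.re → ‖h u‖ ≤ C * ((2 * ‖u‖ + 1) / u.re) ^ 2) {u : ℂ} (hu : 0 < u.re) :
    ‖h u‖ ≤ 1 := by
  have hC : 0 ≤ C := by
    have := (norm_nonneg _).trans (hg 1 (by simp))
    norm_num at this
    linarith
  have hε0 : ∀ ε : ℝ, 0 < ε → ∀ v : ℂ, 0 ≤ v.re → 1 ≤ ‖1 + ε * v‖ := by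
    intro ε hε v hv
    refine le_trans ?_ (re_le_norm _)
    simpa using mul_nonneg hε.le hv
  have hstep : ∀ ε : ℝ, 0 < ε → ∀ᶠ R : ℝ in Filter.atTop,
      ‖h u * ((u ^ 2 + R ^ 2) / R ^ 2) ^ 2 / (1 + ε * u)‖ ≤ 1 := by
    intro ε hε
    filter_upwards [Filter.eventually_gt_atTop ‖u‖, Filter.eventually_ge_atTop 1,
      Filter.eventually_ge_atTop (36 * C / ε)] with R hRu hR1 hRC
    have hR0 : 0 < R := by linarith
    have hR0' : (R : ℂ) ≠ 0 := ofReal_ne_zero.2 hR0.ne'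
    set F : ℂ → ℂ := fun v ↦ h v * ((v ^ 2 + R ^ 2) / R ^ 2) ^ 2 / (1 + ε * v) with hF
    have hFd : ∀ v : ℂ, 0 ≤ v.re → DifferentiableAt ℂ F v := by
      intro v hv
      have : 1 + ε * v ≠ 0 := norm_pos_iff.1 (one_pos.trans_le (hε0 ε hε v hv))
      exact ((hd v hv).mul (by fun_prop)).div (by fun_prop) this
    have hsub : closure ({u : ℂ | 0 < u.re} ∩ Metric.ball 0 R) ⊆ {u | 0 ≤ u.re} :=
      closure_minimal (fun v hv ↦ (show 0 < v.re from hv.1).le)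
        (isClosed_le continuous_const continuous_re)
    refine norm_le_of_forall_mem_frontier_norm_le
      (U := {u : ℂ | 0 < u.re} ∩ Metric.ball 0 R) (f := F)
      (Metric.isBounded_ball.subset Set.inter_subset_right)
      (DifferentiableOn.diffContOnCl fun v hv ↦ (hFd v (hsub hv)).differentiableWithinAt)
      (fun v hv ↦ ?_) (subset_closure ⟨hu, by simpa using hRu⟩)
    rw [hF]
    simp only
    rw [norm_div, norm_mul, norm_pow]
    rcases frontier_half_disc_subset R hv with ⟨hv0, hvR⟩ | ⟨hv0, hvR⟩
    · have h1 := hε0 ε hε v hv0.ge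
      have h2 : v ^ 2 = ((-v.im ^ 2 : ℝ) : ℂ) := by
        apply Complex.ext <;> simp [pow_two, hv0]
      have h3 : v.im ^ 2 ≤ R ^ 2 := sq_le_sq' (by linarith [neg_abs_le v.im, abs_im_le_norm v])
        (by linarith [le_abs_self v.im, abs_im_le_norm v])
      have h4 : ‖(v ^ 2 + R ^ 2) / (R : ℂ) ^ 2‖ ≤ 1 := by
        rw [h2, ← ofReal_pow, ← ofReal_add, ← ofReal_div, Complex.norm_of_nonneg
          (div_nonneg (by linarith) (by positivity)), div_le_one (by positivity)]
        nlinarith [sq_nonneg v.im]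
      rw [div_le_one (by linarith)]
      refine le_trans ?_ h1
      exact mul_le_one₀ (hb v hv0) (by positivity) (pow_le_one₀ (norm_nonneg _) h4)
    · have h1 : ‖(v ^ 2 + R ^ 2) / (R : ℂ) ^ 2‖ = 2 * v.re / R := by
        have : v ^ 2 + (R : ℂ) ^ 2 = v * ((2 * v.re : ℝ) : ℂ) := by
          have hvv : v * (starRingEnd ℂ) v = (R : ℂ) ^ 2 := by
            rw [mul_conj, normSq_eq_norm_sq, hvR]; simp
          rw [← hvv, ← add_conj]; ring
        rw [this, norm_div, norm_mul, hvR, Complex.norm_of_nonneg (by linarith), norm_pow,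
          Complex.norm_of_nonneg hR0.le]
        field_simp
      have h2 : ε * R ≤ ‖1 + ε * v‖ := by
        refine le_of_sq_le_sq ?_ (norm_nonneg _)
        rw [← normSq_eq_norm_sq, normSq_apply, mul_pow, ← hvR, ← normSq_eq_norm_sq, normSq_apply]
        simp
        nlinarith [mul_pos hε hv0]
      have h3 := hg v hv0
      rw [hvR] at h3
      rw [h1, div_le_one (by linarith [mul_pos hε hR0])]
      refine le_trans ?_ h2
      calc ‖h v‖ * (2 * v.re / R) ^ 2 ≤ C * ((2 * R + 1) / v.re) ^ 2 * (2 * v.re / R) ^ 2 := by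
            gcongr
        _ = C * (2 * ((2 * R + 1) / R)) ^ 2 := by field_simp
        _ ≤ C * (2 * 3) ^ 2 := by
            gcongr
            rw [div_le_iff₀ hR0]; linarith
        _ ≤ ε * R := by
            rw [div_le_iff₀ hε] at hRC; linarith
  have hlimR : ∀ ε : ℝ, 0 < ε → ‖h u‖ ≤ ‖1 + ε * u‖ := by
    intro ε hε
    have hpos : 0 < ‖1 + ε * u‖ := one_pos.trans_le (hε0 ε hε u hu.le)
    have ht : Filter.Tendsto (fun R : ℝ ↦ ‖h u * ((u ^ 2 + R ^ 2) / R ^ 2) ^ 2 / (1 + ε * u)‖)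
        Filter.atTop (nhds ‖h u * (u ^ 2 * 0 + 1) ^ 2 / (1 + ε * u)‖) := by
      have h0 : Filter.Tendsto (fun R : ℝ ↦ (((R ^ 2)⁻¹ : ℝ) : ℂ)) Filter.atTop (nhds 0) := by
        rw [← ofReal_zero]
        exact (continuous_ofReal.tendsto 0).comp
          (tendsto_inv_atTop_zero.comp (Filter.tendsto_pow_atTop two_ne_zero))
      refine Filter.Tendsto.congr' ?_
        (((((h0.const_mul (u ^ 2)).add_const 1).pow 2).const_mul (h u)).div_const
          (1 + ε * u)).norm
      filter_upwards [Filter.eventually_gt_atTop 0] with R hR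
      have : (R : ℂ) ≠ 0 := ofReal_ne_zero.2 hR.ne'
      congr 4
      push_cast
      field_simp
    have := le_of_tendsto ht (hstep ε hε)
    simpa [norm_div, div_le_one hpos] using this
  have ht : Filter.Tendsto (fun ε : ℝ ↦ ‖1 + ε * u‖) (nhdsWithin 0 (Set.Ioi 0)) (nhds 1) := by
    have : Continuous fun ε : ℝ ↦ ‖1 + ε * u‖ := by fun_prop
    simpa using (this.tendsto 0).mono_left nhdsWithin_le_nhds
  exact ge_of_tendsto ht (by
    filter_upwards [self_mem_nhdsWithin] with ε hε using hlimR ε hε)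

lemma norm_xi_div_xi_add_one_le_one {u : ℂ} (hu : 0 < u.re) : ‖xi u / xi (u + 1)‖ ≤ 1 := by
  have h0 : ∀ v : ℂ, 0 ≤ v.re → xi (v + 1) ≠ 0 := fun v hv ↦ xi_ne_zero (by simpa)
  refine norm_le_one_of_re_pos_of_growth (h := fun u ↦ xi u / xi (u + 1))
    (fun v hv ↦ (differentiable_xi v).div
      ((differentiable_xi _).comp v (differentiableAt_id.add_const 1)) (h0 v hv)) (fun v hv ↦ ?_)
    (fun v hv ↦ norm_xi_div_xi_add_one_le hv) hu
  rw [norm_div, norm_xi_add_one_of_re_eq_zero hv]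
  exact div_self_le_one _

lemma norm_lt_norm_of_cayley {p : ℝ} (hp : 0 < p) {w : ℂ} (hw : ‖w‖ < 1) :
    ‖(p - 1) + (p + 1) * w‖ < ‖(p + 1) + (p - 1) * w‖ := by
  refine lt_of_pow_lt_pow_left₀ 2 (norm_nonneg _) ?_
  have hw2 : ‖w‖ ^ 2 < 1 := pow_lt_one₀ (norm_nonneg _) hw two_ne_zero
  rw [← normSq_eq_norm_sq, normSq_apply] at hw2 ⊢
  rw [← normSq_eq_norm_sq, normSq_apply]
  simp
  nlinarith [mul_pos hp (sub_pos.2 hw2)]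

lemma norm_sub_div_add_lt_one {p : ℝ} (hp : 0 < p) {u : ℂ} (hu : 0 < u.re) :
    ‖(p - u) / (p + u)‖ < 1 := by
  have h : ‖(p - u : ℂ)‖ < ‖(p + u : ℂ)‖ := by
    refine lt_of_pow_lt_pow_left₀ 2 (norm_nonneg _) ?_
    rw [← normSq_eq_norm_sq, normSq_apply, ← normSq_eq_norm_sq, normSq_apply]
    simp
    nlinarith [mul_pos hp hu]
  rw [norm_div, div_lt_one ((norm_nonneg _).trans_lt h)]
  exact h

lemma re_one_sub_div_one_add_pos {z : ℂ} (hz : ‖z‖ < 1) : 0 < ((1 - z) / (1 + z)).re := by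
  have h1 : 1 + z ≠ 0 := by
    intro h
    rw [← neg_eq_iff_add_eq_zero] at h
    simp [← h] at hz
  have h2 : ‖z‖ ^ 2 < 1 := pow_lt_one₀ (norm_nonneg _) hz two_ne_zero
  rw [← normSq_eq_norm_sq, normSq_apply] at h2
  rw [div_re, ← add_div]
  refine div_pos ?_ (normSq_pos.2 h1)
  simp
  nlinarith

/-- A non-identical holomorphic self-map of the disc has at most one fixed point, and the
derivative there is not one; written in the coordinate `z = (1 - u) / (1 + u)`. -/
lemma unique_fixedPoint_of_norm_lt_one {B : ℂ → ℂ}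
    (hd : ∀ u : ℂ, 0 < u.re → DifferentiableAt ℂ B u) (hb : ∀ u : ℂ, 0 < u.re → ‖B u‖ < 1)
    {p : ℝ} (hp : 0 < p) (hBp : B p = (1 - p) / (1 + p)) (hB1 : B 1 ≠ 0) :
    (∀ u : ℂ, 0 < u.re → B u = (1 - u) / (1 + u) → u = p) ∧
      deriv B p ≠ -2 / (1 + p) ^ 2 := by
  have hp0 : (p : ℂ) ≠ 0 := ofReal_ne_zero.2 hp.ne'
  have hp1 : (1 + p : ℂ) ≠ 0 := by exact_mod_cast (by positivity : (1 + p) ≠ 0)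
  have hp1' : (p + 1 : ℂ) ≠ 0 := by rwa [add_comm]
  have hz1 : ∀ z : ℂ, ‖z‖ < 1 → 1 + z ≠ 0 := by
    intro z hz h
    rw [← neg_eq_iff_add_eq_zero] at h
    simp [← h] at hz
  set c : ℂ → ℂ := fun z ↦ p * ((1 - z) / (1 + z)) with hc
  have hcre : ∀ z : ℂ, ‖z‖ < 1 → 0 < (c z).re := by
    intro z hz
    simp only [hc, re_ofReal_mul]
    exact mul_pos hp (re_one_sub_div_one_add_pos hz)
  have hcinv : ∀ u : ℂ, 0 < u.re → c ((p - u) / (p + u)) = u := by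
    intro u hu
    have : (p + u : ℂ) ≠ 0 := by
      intro h
      have := congrArg re h
      simp at this
      linarith
    have h1 := hz1 _ (norm_sub_div_add_lt_one hp hu)
    simp only [hc]
    rw [mul_div_assoc', div_eq_iff h1]
    field_simp
    ring
  have hc0 : c 0 = p := by simp [hc]
  have hcd : ∀ z : ℂ, ‖z‖ < 1 → DifferentiableAt ℂ c z := fun z hz ↦ by
    have := hz1 z hz
    simp only [hc]
    fun_prop (disch := assumption)
  set g : ℂ → ℂ := fun z ↦ ((p - 1) + (p + 1) * B (c z)) / ((p + 1) + (p - 1) * B (c z)) with hg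
  have hden : ∀ z : ℂ, ‖z‖ < 1 → (p + 1 : ℂ) + (p - 1) * B (c z) ≠ 0 := fun z hz ↦
    norm_pos_iff.1 ((norm_nonneg _).trans_lt (norm_lt_norm_of_cayley hp (hb _ (hcre z hz))))
  have hg0 : g 0 = 0 := by
    simp only [hg, hc0, hBp]
    rw [mul_div_assoc', add_comm (p : ℂ) 1, mul_div_cancel_left₀ _ hp1]
    simp
  have hgd : DifferentiableOn ℂ g (Metric.ball 0 1) := by
    intro z hz
    rw [mem_ball_zero_iff] at hz
    have h1 : DifferentiableAt ℂ (fun z ↦ B (c z)) z := (hd _ (hcre z hz)).comp z (hcd z hz)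
    exact (((h1.const_mul _).const_add _).div ((h1.const_mul _).const_add _)
      (hden z hz)).differentiableWithinAt
  have hgm : Set.MapsTo g (Metric.ball 0 1) (Metric.closedBall (g 0) 1) := by
    intro z hz
    rw [mem_ball_zero_iff] at hz
    rw [hg0, mem_closedBall_zero_iff, hg, norm_div]
    exact div_le_one_of_le₀ (norm_lt_norm_of_cayley hp (hb _ (hcre z hz))).le (norm_nonneg _)
  have key : ∀ z : ℂ, ‖z‖ < 1 → dslope g 0 z ≠ 1 := by
    intro z hz h
    have hEq := affine_of_mapsTo_ball_of_norm_dslope_eq_div hgd hgm (mem_ball_zero_iff.2 hz)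
      (by rw [h]; simp)
    have hone : ‖((p : ℂ) - 1) / (p + 1)‖ < 1 := norm_sub_div_add_lt_one hp (by simp)
    have h1 := hEq (mem_ball_zero_iff.2 hone)
    have h2 := hden _ hone
    have h3 := hcinv 1 (by simp)
    simp only [hg0, h, sub_zero, zero_add] at h1
    simp only [h3] at h2
    simp only [hg, h3] at h1
    apply hB1
    rw [smul_eq_mul, mul_one, div_eq_div_iff h2 hp1'] at h1
    have : 4 * (p : ℂ) * B 1 = 0 := by linear_combination h1
    simpa [hp0] using this
  constructor
  · intro u hu hBu
    by_contra hne
    have hz := norm_sub_div_add_lt_one hp hu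
    have hpu : (p + u : ℂ) ≠ 0 := by
      intro h
      have := congrArg re h
      simp at this
      linarith
    have h1u : (1 + u : ℂ) ≠ 0 := by
      intro h
      have := congrArg re h
      simp at this
      linarith
    have hz0 : (p - u : ℂ) / (p + u) ≠ 0 := div_ne_zero (sub_ne_zero.2 (Ne.symm hne)) hpu
    refine key _ hz ?_
    have hgz : g ((p - u) / (p + u)) = (p - u) / (p + u) := by
      have := hden _ hz
      simp only [hg, hcinv u hu, hBu] at this ⊢
      rw [div_eq_div_iff this hpu]
      field_simp
      ring
    rw [dslope_of_ne _ hz0, slope_def_field, hg0, hgz, sub_zero, div_self hz0]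
  · intro hβ
    refine key 0 (by simp) ?_
    rw [dslope_same]
    have hc' : HasDerivAt c (-2 * p) 0 := by
      have h := (((hasDerivAt_id (0 : ℂ)).const_sub 1).div ((hasDerivAt_id (0 : ℂ)).const_add 1)
        (by simp)).const_mul (p : ℂ)
      refine h.congr_deriv ?_
      simp
      ring
    have hB' : HasDerivAt B (-2 / (1 + p) ^ 2) (c 0) := by
      rw [← hβ, hc0]
      exact (hd p (by simpa)).hasDerivAt
    have hBc := hB'.comp 0 hc'
    have h := ((hBc.const_mul (p + 1 : ℂ)).const_add (p - 1 : ℂ)).div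
      ((hBc.const_mul (p - 1 : ℂ)).const_add (p + 1 : ℂ)) (hden 0 (by simp))
    refine h.deriv.trans ?_
    have h2 := hden 0 (by simp)
    simp only [Function.comp, hc0, hBp] at h2 ⊢
    rw [div_eq_one_iff_eq (pow_ne_zero 2 h2)]
    field_simp
    ring

/-- The entire function `J(u)` with `φ₀(a,s) · a^{-s} · 2s (2s-1) (2s-2) = J(2s-1)`. -/
noncomputable def phi0Entire (a : ℝ) (u : ℂ) : ℂ :=
  (u - 1) * xi (u + 1) + (u + 1) * (a : ℂ) ^ (-u) * xi u

lemma phi0_mul_eq_phi0Entire {a : ℝ} (ha : 0 < a) {s : ℂ} (hs : s ∉ ({0, 1 / 2, 1} : Set ℂ)) :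
    phi0 a s * ((a : ℂ) ^ (-s) * (2 * s * (2 * s - 1) * (2 * s - 2))) =
      phi0Entire a (2 * s - 1) := by
  simp only [Set.mem_insert_iff, Set.mem_singleton_iff, not_or] at hs
  obtain ⟨h0, h2, h1⟩ := hs
  have ha0 : (a : ℂ) ≠ 0 := ofReal_ne_zero.2 ha.ne'
  have e1 : (a : ℂ) ^ s * (a : ℂ) ^ (-s) = 1 := by rw [← cpow_add _ _ ha0]; simp
  have e2 : (a : ℂ) ^ (1 - s) * (a : ℂ) ^ (-s) = (a : ℂ) ^ (-(2 * s - 1)) := by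
    rw [← cpow_add _ _ ha0]; congr 1; ring
  rw [phi0Entire, sub_add_cancel, xi_eq_mul_completedRiemannZeta (s := 2 * s) (by simpa)
    (by intro h; exact h2 (by linear_combination h / 2)),
    xi_eq_mul_completedRiemannZeta (s := 2 * s - 1)
    (by intro h; exact h2 (by linear_combination h / 2))
    (by intro h; exact h1 (by linear_combination h / 2)), phi0, ← e2]
  linear_combination completedRiemannZeta (2 * s) * (2 * s * (2 * s - 1) * (2 * s - 2)) * e1

lemma phi0_multiplier_ne_zero {a : ℝ} (ha : 0 < a) {s : ℂ}
    (hs : s ∉ ({0, 1 / 2, 1} : Set ℂ)) :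
    (a : ℂ) ^ (-s) * (2 * s * (2 * s - 1) * (2 * s - 2)) ≠ 0 := by
  simp only [Set.mem_insert_iff, Set.mem_singleton_iff, not_or] at hs
  obtain ⟨h0, h2, h1⟩ := hs
  have ha0 : (a : ℂ) ≠ 0 := ofReal_ne_zero.2 ha.ne'
  have h3 : 2 * s - 1 ≠ 0 := fun h ↦ h2 (by linear_combination h / 2)
  have h4 : 2 * s - 2 ≠ 0 := fun h ↦ h1 (by linear_combination h / 2)
  simp [cpow_eq_zero_iff, ha0, h0, h3, h4]

lemma phi0_eq_zero_iff {a : ℝ} (ha : 0 < a) {s : ℂ} (hs : s ∉ ({0, 1 / 2, 1} : Set ℂ)) :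
    phi0 a s = 0 ↔ phi0Entire a (2 * s - 1) = 0 := by
  rw [← phi0_mul_eq_phi0Entire ha hs, mul_eq_zero, or_iff_left (phi0_multiplier_ne_zero ha hs)]

lemma phi0_one_sub (a : ℝ) (s : ℂ) : phi0 a (1 - s) = phi0 a s := by
  rw [phi0, phi0, ← completedRiemannZeta_one_sub (2 * s), ← completedRiemannZeta_one_sub
    (2 * s - 1), sub_sub_cancel, add_comm]
  congr 3 <;> ring_nf

lemma differentiable_phi0Entire {a : ℝ} (ha : 0 < a) : Differentiable ℂ (phi0Entire a) := by
  have ha0 : (a : ℂ) ≠ 0 := ofReal_ne_zero.2 ha.ne'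
  have h1 : Differentiable ℂ fun u : ℂ ↦ (a : ℂ) ^ (-u) :=
    fun u ↦ differentiableAt_id.neg.const_cpow (Or.inl ha0)
  have h2 : Differentiable ℂ fun u : ℂ ↦ xi (u + 1) :=
    differentiable_xi.comp (differentiable_id.add_const 1)
  exact ((differentiable_id.sub_const 1).mul h2).add
    (((differentiable_id.add_const 1).mul h1).mul differentiable_xi)

@[simp] lemma phi0Entire_zero (a : ℝ) : phi0Entire a 0 = 0 := by simp [phi0Entire]

lemma phi0Entire_one (a : ℝ) : phi0Entire a 1 = ((2 * a⁻¹ : ℝ) : ℂ) := by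
  simp [phi0Entire, cpow_neg_one]; norm_num

lemma hasDerivAt_xi (s : ℂ) :
    HasDerivAt xi ((2 * s - 1) * completedRiemannZeta₀ s +
      s * (s - 1) * deriv completedRiemannZeta₀ s) s := by
  refine ((((hasDerivAt_id s).mul ((hasDerivAt_id s).sub_const 1)).mul
    (differentiable_completedZeta₀ s).hasDerivAt).add_const 1).congr_deriv ?_
  simp only [id_eq, Pi.mul_apply]; ring

lemma hasDerivAt_phi0Entire_zero {a : ℝ} (ha : 0 < a) :
    HasDerivAt (phi0Entire a) ((Real.log aStar - Real.log a : ℝ) : ℂ) 0 := by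
  have ha0 : (a : ℂ) ≠ 0 := ofReal_ne_zero.2 ha.ne'
  have h0 : completedRiemannZeta₀ 0 = completedRiemannZeta₀ 1 := by
    rw [← completedRiemannZeta₀_one_sub, sub_zero]
  have h1 : HasDerivAt (fun u : ℂ ↦ (a : ℂ) ^ (-u)) ((a : ℂ) ^ (-(0 : ℂ)) * Complex.log a * -1) 0 :=
    (hasDerivAt_neg (0 : ℂ)).const_cpow (Or.inl ha0)
  have h2 : HasDerivAt (fun u : ℂ ↦ xi (u + 1)) _ 0 := (hasDerivAt_xi (0 + 1)).comp_add_const 0 1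
  have h := (((hasDerivAt_id (0 : ℂ)).sub_const 1).mul h2).add
    ((((hasDerivAt_id (0 : ℂ)).add_const 1).mul h1).mul (hasDerivAt_xi 0))
  refine h.congr_deriv ?_
  have hlog : Real.log aStar = Real.log (4 * Real.pi) - Real.eulerMascheroniConstant := by
    rw [aStar, Real.log_mul (by positivity) (Real.exp_ne_zero _), Real.log_exp]; ring
  have hlog4 : ((Real.log (4 * Real.pi) : ℝ) : ℂ) = Complex.log (4 * Real.pi) := by
    rw [ofReal_log (by positivity)]; push_cast; rfl
  rw [hlog]
  push_cast
  rw [hlog4, ofReal_log ha.le]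
  simp [h0, completedRiemannZeta₀_one]
  ring

lemma xi_ofReal_im {x : ℝ} (hx : 0 < x) : (xi x).im = 0 := by
  have h := xi_conj (s := x) (by simpa)
  rw [conj_ofReal] at h
  exact conj_eq_iff_im.1 h.symm

lemma phi0Entire_ofReal_im {a : ℝ} (ha : 0 < a) {x : ℝ} (hx : 0 < x) :
    (phi0Entire a x).im = 0 := by
  have h1 := xi_ofReal_im hx
  have h2 : (xi (x + 1)).im = 0 := by
    have := xi_ofReal_im (show 0 < x + 1 by linarith)
    rwa [ofReal_add, ofReal_one] at this
  have h3 : (a : ℂ) ^ (-(x : ℂ)) = ((a ^ (-x) : ℝ) : ℂ) := by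
    rw [ofReal_cpow ha.le, ofReal_neg]
  rw [phi0Entire, h3]
  simp [h1, h2]

open Filter Topology in
lemma exists_phi0Entire_eq_zero {a : ℝ} (ha : aStar < a) :
    ∃ p ∈ Set.Ioo (0 : ℝ) 1, phi0Entire a p = 0 := by
  have hs0 : 0 < aStar := by rw [aStar]; positivity
  have ha0 : 0 < a := hs0.trans ha
  have hd := (hasDerivAt_phi0Entire_zero ha0)
  have hj : HasDerivAt (fun x : ℝ ↦ (phi0Entire a x).re) (Real.log aStar - Real.log a) 0 := by
    rw [← ofReal_zero] at hd
    simpa using hd.real_of_complex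
  have hneg : Real.log aStar - Real.log a < 0 := sub_neg.2 (Real.log_lt_log hs0 ha)
  have hev : ∀ᶠ x : ℝ in 𝓝[>] 0, (phi0Entire a x).re < 0 := by
    have h1 := (hasDerivAt_iff_tendsto_slope.1 hj).eventually_lt_const hneg
    have h2 : 𝓝[>] (0 : ℝ) ≤ 𝓝[≠] 0 := nhdsWithin_mono _ fun x hx ↦ (Set.mem_Ioi.1 hx).ne'
    filter_upwards [h2 h1, self_mem_nhdsWithin] with x hx hx0
    rw [slope_def_field] at hx
    simp only [ofReal_zero, phi0Entire_zero, zero_re, sub_zero] at hx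
    exact neg_of_div_neg_left hx (le_of_lt hx0)
  obtain ⟨x, hxneg, hx⟩ := (hev.and (Ioo_mem_nhdsGT (zero_lt_one' ℝ))).exists
  have hcont : Continuous fun x : ℝ ↦ (phi0Entire a x).re :=
    continuous_re.comp ((differentiable_phi0Entire ha0).continuous.comp continuous_ofReal)
  have hone : 0 < (phi0Entire a (1 : ℝ)).re := by
    rw [ofReal_one, phi0Entire_one, ofReal_re]; positivity
  obtain ⟨p, hp, hp0⟩ := intermediate_value_Ioo hx.2.le hcont.continuousOn ⟨hxneg, hone⟩
  exact ⟨p, ⟨hx.1.trans hp.1, hp.2⟩, Complex.ext hp0 (phi0Entire_ofReal_im ha0 (hx.1.trans hp.1))⟩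

lemma phi0Entire_unique_simple_zero {a : ℝ} (ha : 1 < a) {p : ℝ} (hp : 0 < p)
    (hp0 : phi0Entire a p = 0) :
    (∀ u : ℂ, 0 < u.re → phi0Entire a u = 0 → u = p) ∧ deriv (phi0Entire a) p ≠ 0 := by
  have ha0 : 0 < a := by linarith
  have ha0' : (a : ℂ) ≠ 0 := ofReal_ne_zero.2 ha0.ne'
  set B : ℂ → ℂ := fun u ↦ (a : ℂ) ^ (-u) * (xi u / xi (u + 1)) with hB
  have hξ : ∀ u : ℂ, 0 < u.re → xi (u + 1) ≠ 0 := fun u hu ↦ xi_ne_zero (by simpa using hu.le)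
  have h1u : ∀ u : ℂ, 0 < u.re → 1 + u ≠ 0 := fun u hu h ↦ by
    have := congrArg re h
    simp at this
    linarith
  have hJ : ∀ u : ℂ, 0 < u.re →
      phi0Entire a u = xi (u + 1) * ((1 + u) * B u - (1 - u)) := by
    intro u hu
    have := hξ u hu
    simp only [hB, phi0Entire]
    field_simp
    ring
  have hiff : ∀ u : ℂ, 0 < u.re → (phi0Entire a u = 0 ↔ B u = (1 - u) / (1 + u)) := by
    intro u hu
    rw [hJ u hu, mul_eq_zero, or_iff_right (hξ u hu), sub_eq_zero, eq_div_iff (h1u u hu), mul_comm]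
  have hBd : ∀ u : ℂ, 0 < u.re → DifferentiableAt ℂ B u := fun u hu ↦
    (differentiableAt_id.neg.const_cpow (Or.inl ha0')).mul ((differentiable_xi u).div
      ((differentiable_xi _).comp u (differentiableAt_id.add_const 1)) (hξ u hu))
  have hBn : ∀ u : ℂ, 0 < u.re → ‖B u‖ < 1 := by
    intro u hu
    rw [hB, norm_mul, norm_cpow_eq_rpow_re_of_pos ha0]
    exact mul_lt_one_of_nonneg_of_lt_one_left (by positivity)
      (Real.rpow_lt_one_of_one_lt_of_neg ha (by simpa)) (norm_xi_div_xi_add_one_le_one hu)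
  have hB1 : B 1 ≠ 0 := by
    simp only [hB, xi_one]
    exact mul_ne_zero (by simp [cpow_eq_zero_iff, ha0'])
      (div_ne_zero one_ne_zero (hξ 1 (by simp)))
  have hpre : 0 < (p : ℂ).re := by simpa
  have hBp := (hiff p hpre).1 hp0
  obtain ⟨huniq, hder⟩ := unique_fixedPoint_of_norm_lt_one hBd hBn hp hBp hB1
  refine ⟨fun u hu h ↦ huniq u hu ((hiff u hu).1 h), fun h ↦ hder ?_⟩
  have hξd : HasDerivAt (fun u : ℂ ↦ xi (u + 1)) (deriv xi (p + 1)) p :=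
    (differentiable_xi _).hasDerivAt.comp_add_const _ _
  have hK := hξd.mul ((((hasDerivAt_id (p : ℂ)).const_add 1).mul (hBd p hpre).hasDerivAt).sub
    ((hasDerivAt_id (p : ℂ)).const_sub 1))
  have hev : phi0Entire a =ᶠ[nhds (p : ℂ)]
      fun u ↦ xi (u + 1) * ((1 + u) * B u - (1 - u)) := by
    filter_upwards [(isOpen_lt continuous_const continuous_re).mem_nhds hpre] with u hu
    exact hJ u hu
  have hK' := (hK.congr_of_eventuallyEq hev).deriv
  have h1p := h1u p hpre
  rw [h] at hK'
  simp only [id, Pi.sub_apply, Pi.mul_apply, hBp] at hK'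
  rw [mul_div_cancel₀ _ h1p, sub_self, mul_zero, zero_add] at hK'
  have hK2 := (mul_eq_zero.1 hK'.symm).resolve_left (hξ p hpre)
  rw [eq_div_iff (pow_ne_zero 2 h1p)]
  field_simp at hK2
  linear_combination hK2

lemma deriv_phi0_ne_zero {a : ℝ} (ha : 0 < a) {s : ℂ} (hs : s ∉ ({0, 1 / 2, 1} : Set ℂ))
    (h0 : phi0 a s = 0) (hJ : deriv (phi0Entire a) (2 * s - 1) ≠ 0) :
    DifferentiableAt ℂ (phi0 a) s ∧ deriv (phi0 a) s ≠ 0 := by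
  have ha0 : (a : ℂ) ≠ 0 := ofReal_ne_zero.2 ha.ne'
  have hs' := hs
  simp only [Set.mem_insert_iff, Set.mem_singleton_iff, not_or] at hs'
  obtain ⟨hs0, hs2, hs1⟩ := hs'
  have hd : DifferentiableAt ℂ (phi0 a) s := by
    have h1 : DifferentiableAt ℂ (fun s ↦ completedRiemannZeta (2 * s)) s :=
      (differentiableAt_completedZeta (by simpa)
        (fun h ↦ hs2 (by linear_combination h / 2))).comp s (differentiableAt_id.const_mul 2)
    have h2 : DifferentiableAt ℂ (fun s ↦ completedRiemannZeta (2 * s - 1)) s :=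
      (differentiableAt_completedZeta (fun h ↦ hs2 (by linear_combination h / 2))
        (fun h ↦ hs1 (by linear_combination h / 2))).comp s
          ((differentiableAt_id.const_mul 2).sub_const 1)
    exact (h1.mul (differentiableAt_id.const_cpow (Or.inl ha0))).add
      (h2.mul ((differentiableAt_id.const_sub 1).const_cpow (Or.inl ha0)))
  refine ⟨hd, fun h ↦ hJ ?_⟩
  have hm : DifferentiableAt ℂ
      (fun s : ℂ ↦ (a : ℂ) ^ (-s) * (2 * s * (2 * s - 1) * (2 * s - 2))) s :=
    (differentiableAt_id.neg.const_cpow (Or.inl ha0)).mul (by fun_prop)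
  have h1 := hd.hasDerivAt.mul hm.hasDerivAt
  rw [h0, h, zero_mul, zero_mul, zero_add] at h1
  have hl : HasDerivAt (fun s : ℂ ↦ 2 * s - 1) 2 s := by
    simpa using ((hasDerivAt_id s).const_mul 2).sub_const 1
  have h2 := ((differentiable_phi0Entire ha) (2 * s - 1)).hasDerivAt.comp s hl
  have hev : (phi0Entire a ∘ fun s : ℂ ↦ 2 * s - 1) =ᶠ[nhds s] fun s ↦
      phi0 a s * ((a : ℂ) ^ (-s) * (2 * s * (2 * s - 1) * (2 * s - 2))) := by
    have hopen : IsOpen ({0, 1 / 2, 1} : Set ℂ)ᶜ := (Set.toFinite _).isClosed.isOpen_compl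
    filter_upwards [hopen.mem_nhds hs] with z hz
    exact (phi0_mul_eq_phi0Entire ha hz).symm
  simpa using h2.unique (h1.congr_of_eventuallyEq hev)

lemma one_lt_aStar : 1 < aStar := by
  have hγ := Real.eulerMascheroniConstant_lt_two_thirds
  have h1 : Real.exp (-1) ≤ Real.exp (-Real.eulerMascheroniConstant) :=
    Real.exp_le_exp.2 (by linarith)
  have h2 : (1 / 3 : ℝ) < Real.exp (-1) := by
    rw [Real.exp_neg, one_div]
    exact inv_strictAnti₀ (Real.exp_pos _) (Real.exp_one_lt_d9.trans (by norm_num))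
  rw [aStar]
  nlinarith [Real.pi_gt_three]

/-- For `a > a* = 4πe^{-γ}` there is exactly one `ρ_a ∈ (1/2, 1)` with `φ₀(a, ρ_a) = 0`;
moreover `φ₀(a, 1 - ρ_a) = 0`, both `ρ_a` and `1 - ρ_a` are simple zeros, and every zero
`s ∉ {0, 1/2, 1}` of `φ₀(a,·)` off the critical line belongs to `{ρ_a, 1 - ρ_a}`. -/
theorem phi0_off_line_zeros (a : ℝ) (ha : aStar < a) :
    ∃ ρ : ℝ, ρ ∈ Set.Ioo (1 / 2 : ℝ) 1 ∧ phi0 a ρ = 0 ∧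
      (∀ ρ' ∈ Set.Ioo (1 / 2 : ℝ) 1, phi0 a ρ' = 0 → ρ' = ρ) ∧
      phi0 a (1 - (ρ : ℂ)) = 0 ∧
      deriv (phi0 a) (ρ : ℂ) ≠ 0 ∧
      deriv (phi0 a) (1 - (ρ : ℂ)) ≠ 0 ∧
      ∀ s : ℂ, s ∉ ({0, 1 / 2, 1} : Set ℂ) → s.re ≠ 1 / 2 → phi0 a s = 0 →
        s = (ρ : ℂ) ∨ s = 1 - (ρ : ℂ) := by
  have ha1 : 1 < a := one_lt_aStar.trans ha
  have ha0 : 0 < a := by linarith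
  obtain ⟨p, hp, hJp⟩ := exists_phi0Entire_eq_zero ha
  obtain ⟨huniq, hder⟩ := phi0Entire_unique_simple_zero ha1 hp.1 hJp
  have hmem : ∀ x ∈ Set.Ioo (1 / 2 : ℝ) 1, (x : ℂ) ∉ ({0, 1 / 2, 1} : Set ℂ) := by
    rintro x ⟨h1, h2⟩ h
    simp only [Set.mem_insert_iff, Set.mem_singleton_iff] at h
    rcases h with h | h | h <;> have := congrArg re h <;> norm_num at this <;> linarith
  have hright : ∀ s : ℂ, s ∉ ({0, 1 / 2, 1} : Set ℂ) → 1 / 2 < s.re → phi0 a s = 0 →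
      s = (((1 + p) / 2 : ℝ) : ℂ) := by
    intro s hs hre h
    have := huniq (2 * s - 1) (by simp; linarith) ((phi0_eq_zero_iff ha0 hs).1 h)
    push_cast
    linear_combination this / 2
  have hρ : (1 + p) / 2 ∈ Set.Ioo (1 / 2 : ℝ) 1 := ⟨by linarith [hp.1], by linarith [hp.2]⟩
  have hρp : 2 * (((1 + p) / 2 : ℝ) : ℂ) - 1 = p := by push_cast; ring
  have hzero : phi0 a (((1 + p) / 2 : ℝ) : ℂ) = 0 := by
    rw [phi0_eq_zero_iff ha0 (hmem _ hρ), hρp, hJp]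
  obtain ⟨hdiff, hder'⟩ := deriv_phi0_ne_zero ha0 (hmem _ hρ) hzero (by rwa [hρp])
  refine ⟨(1 + p) / 2, hρ, hzero, fun x hx h ↦ ?_, by rw [phi0_one_sub, hzero], hder', ?_, ?_⟩
  · exact ofReal_injective (hright x (hmem x hx) (by simpa using hx.1) h)
  · have hfun : phi0 a = fun s ↦ phi0 a (1 - s) := funext fun s ↦ (phi0_one_sub a s).symm
    rw [hfun, deriv_comp_const_sub, sub_sub_cancel]
    exact neg_ne_zero.2 hder'
  · intro s hs hre h
    rcases lt_or_gt_of_ne hre with hlt | hgt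
    · right
      rw [← hright (1 - s) ?_ (by simp; linarith) (by rwa [phi0_one_sub]), sub_sub_cancel]
      simp only [Set.mem_insert_iff, Set.mem_singleton_iff, not_or] at hs ⊢
      refine ⟨fun h ↦ hs.2.2 ?_, fun h ↦ hs.2.1 ?_, fun h ↦ hs.1 ?_⟩ <;> linear_combination -h
    · exact Or.inl (hright s hs hgt h)
end

section
/- The off-line real zero of φ₀(a,·) is a nondecreasing function of a tending to 1: if a* < a ≤ a′ and ρ ∈ (1/2, 1), ρ′ ∈ (1/2, 1) satisfy φ₀(a, ρ) = 0 and φ₀(a′, ρ′) = 0, then ρ ≤ ρ′; moreover, for every ε > 0 there exists A > a* such that for all a > A, every zero ρ ∈ (1/2, 1) of φ₀(a,·) satisfies ρ > 1 - ε. -/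
open Complex

open HurwitzZeta Set MeasureTheory

lemma one_le_evenKernel_zero {t : ℝ} (ht : 0 < t) : 1 ≤ evenKernel 0 t := by
  have h := hasSum_int_evenKernel₀ 0 ht
  have h0 := h.nonneg fun n ↦ by split_ifs <;> positivity
  simpa using h0

/-- The Mellin integrand defining the entire part of the completed zeta function is real and
nonnegative. -/
lemma exists_nonneg_f_modif_eq {t : ℝ} (ht : 0 < t) :
    ∃ r : ℝ, 0 ≤ r ∧ (hurwitzEvenFEPair 0).f_modif t = r := by
  rcases lt_trichotomy t 1 with h | rfl | h
  · refine ⟨evenKernel 0 t - t ^ (-(1 / 2) : ℝ), ?_, ?_⟩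
    · have h1 := one_le_evenKernel_zero (one_div_pos.2 ht)
      rw [evenKernel_functional_equation, ← evenKernel_eq_cosKernel_of_zero, Real.rpow_neg ht.le,
        one_div (t ^ _), sub_nonneg]
      exact le_mul_of_one_le_right (by positivity) h1
    · simp [WeakFEPair.f_modif, hurwitzEvenFEPair, h, ht, h.le]
  · exact ⟨0, le_rfl, by simp [WeakFEPair.f_modif]⟩
  · refine ⟨evenKernel 0 t - 1, sub_nonneg.2 (one_le_evenKernel_zero ht), ?_⟩
    simp [WeakFEPair.f_modif, hurwitzEvenFEPair, h, h.le]

lemma integrableOn_norm_mellin_f_modif (s : ℂ) :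
    IntegrableOn (fun t : ℝ ↦ ‖(t : ℂ) ^ (s - 1) • (hurwitzEvenFEPair 0).f_modif t‖) (Ioi 0) :=
  ((hurwitzEvenFEPair 0).isStrongFEPair_toStrongFEPair.hasMellin s).1.norm

lemma integral_norm_mellin_f_modif (σ : ℝ) :
    ∫ t : ℝ in Ioi 0, ‖(t : ℂ) ^ ((σ : ℂ) - 1) • (hurwitzEvenFEPair 0).f_modif t‖ =
      ‖(hurwitzEvenFEPair 0).Λ₀ σ‖ := by
  have h : (hurwitzEvenFEPair 0).Λ₀ σ = ((∫ t : ℝ in Ioi 0,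
      ‖(t : ℂ) ^ ((σ : ℂ) - 1) • (hurwitzEvenFEPair 0).f_modif t‖ : ℝ) : ℂ) := by
    rw [← integral_complex_ofReal]
    refine setIntegral_congr_fun measurableSet_Ioi fun t (ht : 0 < t) ↦ ?_
    obtain ⟨r, hr, hr'⟩ := exists_nonneg_f_modif_eq ht
    have : (t : ℂ) ^ ((σ : ℂ) - 1) = ((t ^ (σ - 1) : ℝ) : ℂ) := by
      rw [ofReal_cpow ht.le]; simp
    simp only [hr', this, smul_eq_mul, ← ofReal_mul, norm_real]
    rw [Real.norm_of_nonneg (by positivity)]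
  rw [h, norm_real, Real.norm_of_nonneg (integral_nonneg fun _ ↦ norm_nonneg _)]

lemma norm_Λ₀_le {s : ℂ} {σ τ : ℝ} (h₁ : σ ≤ s.re) (h₂ : s.re ≤ τ) :
    ‖(hurwitzEvenFEPair 0).Λ₀ s‖ ≤
      ‖(hurwitzEvenFEPair 0).Λ₀ σ‖ + ‖(hurwitzEvenFEPair 0).Λ₀ τ‖ := by
  rw [← integral_norm_mellin_f_modif σ, ← integral_norm_mellin_f_modif τ,
    ← integral_add (integrableOn_norm_mellin_f_modif σ) (integrableOn_norm_mellin_f_modif τ)]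
  refine (norm_integral_le_integral_norm _).trans ?_
  refine setIntegral_mono_on (integrableOn_norm_mellin_f_modif s)
    ((integrableOn_norm_mellin_f_modif σ).add (integrableOn_norm_mellin_f_modif τ))
    measurableSet_Ioi fun t (ht : 0 < t) ↦ ?_
  simp only [norm_smul, norm_cpow_eq_rpow_re_of_pos ht, sub_re, ofReal_re, one_re]
  rw [← add_mul]
  refine mul_le_mul_of_nonneg_right ?_ (norm_nonneg _)
  rcases le_total t 1 with h | h
  · exact (Real.rpow_le_rpow_of_exponent_ge ht h (by linarith)).trans
      (le_add_of_nonneg_right (by positivity))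
  · exact (Real.rpow_le_rpow_of_exponent_le h (by linarith)).trans
      (le_add_of_nonneg_left (by positivity))

lemma completedRiemannZeta₀_four :
    completedRiemannZeta₀ 4 = ((Real.pi ^ 2 / 90 - 1 / 12 : ℝ) : ℂ) := by
  have h := riemannZeta_four
  have hpi : (Real.pi : ℂ) ≠ 0 := by exact_mod_cast Real.pi_ne_zero
  rw [riemannZeta_def_of_ne_zero (by norm_num), completedRiemannZeta_eq, Gammaℝ_def] at h
  have h1 : (Real.pi : ℂ) ^ (-4 / 2 : ℂ) = ((Real.pi : ℂ) ^ 2)⁻¹ := by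
    rw [show (-4 / 2 : ℂ) = -((2 : ℕ) : ℂ) by norm_num, cpow_neg, cpow_natCast]
  have h2 : Gamma (4 / 2) = 1 := by norm_num
  rw [h1, h2, mul_one, div_inv_eq_mul] at h
  push_cast
  have h3 := mul_right_cancel₀ (pow_ne_zero 2 hpi)
    (h.trans (show (Real.pi : ℂ) ^ 4 / 90 = (Real.pi ^ 2 / 90) * Real.pi ^ 2 by ring))
  linear_combination h3

lemma norm_completedRiemannZeta₀_le {s : ℂ} (h₁ : -3 ≤ s.re) (h₂ : s.re ≤ 4) :
    ‖completedRiemannZeta₀ s‖ ≤ 1 / 12 := by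
  have key : ‖completedRiemannZeta₀ s‖ ≤
      ‖completedRiemannZeta₀ (-3)‖ + ‖completedRiemannZeta₀ 4‖ := by
    have h := norm_Λ₀_le (s := s / 2) (σ := -3 / 2) (τ := 4 / 2)
      (by simp; linarith) (by simp; linarith)
    push_cast at h
    simp only [completedRiemannZeta₀, completedHurwitzZetaEven₀, norm_div, Complex.norm_ofNat]
    linarith
  have h3 : completedRiemannZeta₀ (-3) = completedRiemannZeta₀ 4 := by
    rw [← completedRiemannZeta₀_one_sub]; norm_num
  rw [h3, completedRiemannZeta₀_four, norm_real, Real.norm_eq_abs] at key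
  have hpi := Real.pi_lt_d2
  have hpi' := Real.pi_gt_three
  have : |Real.pi ^ 2 / 90 - 1 / 12| ≤ 1 / 24 := by
    rw [abs_le]; constructor <;> nlinarith
  linarith

lemma completedRiemannZeta_eq_div {s : ℂ} (h0 : s ≠ 0) (h1 : s ≠ 1) :
    completedRiemannZeta s =
      -(1 + -(s * (1 - s) * completedRiemannZeta₀ s)) / (s * (1 - s)) := by
  have : 1 - s ≠ 0 := sub_ne_zero.2 h1.symm
  rw [completedRiemannZeta_eq]
  field_simp
  ring

lemma norm_mul_completedRiemannZeta₀_le {s : ℂ} (hs : ‖s‖ ≤ 2) :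
    ‖-(s * (1 - s) * completedRiemannZeta₀ s)‖ ≤ 1 / 2 := by
  have hre := abs_le.1 ((abs_re_le_norm s).trans hs)
  have h1 := norm_completedRiemannZeta₀_le (s := s) (by linarith) (by linarith)
  have h2 : ‖1 - s‖ ≤ 3 := (norm_sub_le _ _).trans (by simp; linarith)
  rw [norm_neg, norm_mul, norm_mul]
  calc ‖s‖ * ‖1 - s‖ * ‖completedRiemannZeta₀ s‖ ≤ 2 * 3 * (1 / 12) := by gcongr
    _ = 1 / 2 := by norm_num

lemma one_add_mul_completedRiemannZeta₀_ne_zero {s : ℂ} (hs : ‖s‖ ≤ 2) :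
    1 + -(s * (1 - s) * completedRiemannZeta₀ s) ≠ 0 :=
  slitPlane_ne_zero (mem_slitPlane_of_norm_lt_one
    ((norm_mul_completedRiemannZeta₀_le hs).trans_lt one_half_lt_one))

lemma completedRiemannZeta_ne_zero_of_norm_lt_one {s : ℂ} (h0 : s ≠ 0) (h : ‖s‖ < 1) :
    completedRiemannZeta s ≠ 0 := by
  have h1 : s ≠ 1 := by
    rintro rfl
    simp at h
  rw [completedRiemannZeta_eq_div h0 h1]
  exact div_ne_zero (neg_ne_zero.2 (one_add_mul_completedRiemannZeta₀_ne_zero (by linarith)))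
    (mul_ne_zero h0 (sub_ne_zero.2 h1.symm))

/-- The logarithm of `-s (1 - s) Λ(s)`, holomorphic near the disc `‖s‖ ≤ 2`. -/
noncomputable def logXi (s : ℂ) : ℂ := log (1 + -(s * (1 - s) * completedRiemannZeta₀ s))

lemma norm_logXi_le {s : ℂ} (hs : ‖s‖ ≤ 2) : ‖logXi s‖ ≤ 3 / 4 := by
  have h := norm_mul_completedRiemannZeta₀_le hs
  have := norm_log_one_add_half_le_self h
  rw [logXi]
  linarith

lemma differentiableAt_logXi {s : ℂ} (hs : ‖s‖ ≤ 2) : DifferentiableAt ℂ logXi s := by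
  have h := norm_mul_completedRiemannZeta₀_le hs
  have hd := differentiable_completedZeta₀ s
  refine DifferentiableAt.clog (by fun_prop) (mem_slitPlane_of_norm_lt_one (by linarith))

lemma diffContOnCl_logXi : DiffContOnCl ℂ logXi (Metric.ball 0 2) := by
  refine DifferentiableOn.diffContOnCl fun s hs ↦
    (differentiableAt_logXi ?_).differentiableWithinAt
  simpa [closure_ball] using hs

/-- The real part of the `n`-th Taylor coefficient of `logXi` at `0`. -/
noncomputable def logXiCoeff (n : ℕ) : ℝ := ((n.factorial : ℂ)⁻¹ * iteratedDeriv n logXi 0).re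

lemma abs_logXiCoeff_le (n : ℕ) : |logXiCoeff n| ≤ 3 / 4 / 2 ^ n := by
  have h := norm_iteratedDeriv_le_of_forall_mem_sphere_norm_le (C := 3 / 4) n two_pos
    diffContOnCl_logXi fun z hz ↦ norm_logXi_le (by simpa using (mem_sphere_zero_iff_norm.1 hz).le)
  refine (abs_re_le_norm _).trans ?_
  rw [norm_mul, norm_inv, norm_natCast, inv_mul_le_iff₀ (by positivity)]
  rwa [mul_div_assoc] at h

lemma hasSum_re_logXi {x : ℝ} (hx : |x| < 2) :
    HasSum (fun n ↦ logXiCoeff n * x ^ n) (logXi x).re := by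
  have h := hasSum_taylorSeries_on_ball diffContOnCl_logXi.differentiableOn
    (show (x : ℂ) ∈ Metric.ball 0 2 by simpa using hx)
  refine (hasSum_re h).congr_fun fun n ↦ ?_
  rw [logXiCoeff, ← re_mul_ofReal]
  push_cast
  simp only [smul_eq_mul, sub_zero]
  ring_nf

lemma hasSum_odd_re_logXi {x : ℝ} (hx : |x| < 2) :
    HasSum (fun k : ℕ ↦ 2 * logXiCoeff (2 * k + 1) * x ^ (2 * k + 1))
      ((logXi x).re - (logXi (-x : ℝ)).re) := by
  have h := (hasSum_re_logXi hx).sub (hasSum_re_logXi (x := -x) (by simpa using hx))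
  have hinj : Function.Injective fun k : ℕ ↦ 2 * k + 1 := fun a b h ↦ by simpa using h
  rw [← hinj.hasSum_iff] at h
  · refine h.congr_fun fun k ↦ ?_
    simp only [Function.comp_apply, Odd.neg_pow ⟨k, rfl⟩]
    ring
  · intro n hn
    have : Even n := by
      by_contra hodd
      obtain ⟨k, hk⟩ := Nat.not_even_iff_odd.1 hodd
      exact hn ⟨k, hk.symm⟩
    simp [this.neg_pow]

/-- The value of `log a` for which `φ₀(a, (1 + u) / 2) = 0`, for `u ∈ (0, 1)`. -/
noncomputable def logParam (u : ℝ) : ℝ :=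
  (Real.log ‖completedRiemannZeta u‖ - Real.log ‖completedRiemannZeta (-u : ℝ)‖) / u

lemma log_norm_completedRiemannZeta {x : ℝ} (h0 : x ≠ 0) (h1 : |x| < 1) :
    Real.log ‖completedRiemannZeta x‖ =
      (logXi x).re - Real.log |x| - Real.log (1 - x) := by
  have hx := abs_lt.1 h1
  have hx1 : (0 : ℝ) < 1 - x := by linarith
  have hne := one_add_mul_completedRiemannZeta₀_ne_zero (s := x) (by simp; linarith)
  rw [completedRiemannZeta_eq_div (by exact_mod_cast h0) (by exact_mod_cast hx.2.ne), norm_div,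
    norm_neg, norm_mul, norm_real, Real.norm_eq_abs, ← ofReal_one, ← ofReal_sub, norm_real,
    Real.norm_of_nonneg hx1.le, Real.log_div, Real.log_mul, logXi, log_re]
  · push_cast
    ring
  · exact abs_ne_zero.2 h0
  · exact hx1.ne'
  · simpa using hne
  · exact mul_ne_zero (abs_ne_zero.2 h0) hx1.ne'

lemma hasSum_logParam {u : ℝ} (hu : u ∈ Ioo (0 : ℝ) 1) :
    HasSum (fun k : ℕ ↦ 2 * (1 / (2 * k + 1) + logXiCoeff (2 * k + 1)) * u ^ (2 * k))
      (logParam u) := by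
  have habs : |u| < 1 := by rw [abs_of_pos hu.1]; exact hu.2
  have h := (((Real.hasSum_log_sub_log_of_abs_lt_one habs).add
    (hasSum_odd_re_logXi (habs.trans one_lt_two))).div_const u)
  have hne := hu.1.ne'
  convert! h using 1
  · ext k
    field_simp
    ring
  · rw [logParam, log_norm_completedRiemannZeta hne habs,
      log_norm_completedRiemannZeta (neg_ne_zero.2 hne) (by simpa using habs), abs_neg]
    ring_nf

lemma strictMonoOn_logParam : StrictMonoOn logParam (Ioo 0 1) := by
  intro u hu v hv huv
  have hc (k : ℕ) (hk : 1 ≤ k) : 0 < 1 / (2 * k + 1) + logXiCoeff (2 * k + 1) := by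
    have h1 := (abs_le.1 (abs_logXiCoeff_le (2 * k + 1))).1
    have h2 : (3 / 4 : ℝ) / 2 ^ (2 * k + 1) < 1 / (2 * k + 1) := by
      have h3 : ((2 * k + 1 : ℕ) : ℝ) < ((2 ^ (2 * k + 1) : ℕ) : ℝ) :=
        Nat.cast_lt.2 Nat.lt_two_pow_self
      push_cast at h3
      rw [div_lt_div_iff₀ (by positivity) (by positivity)]
      linarith
    linarith
  refine hasSum_lt (i := 1) (fun k ↦ ?_) ?_ (hasSum_logParam hu) (hasSum_logParam hv)
  · rcases Nat.eq_zero_or_pos k with rfl | hk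
    · simp
    · have := hc k hk
      have := hu.1.le
      simp only
      gcongr
  · have := hc 1 le_rfl
    have := hu.1.le
    gcongr

lemma log_eq_logParam {a ρ : ℝ} (ha : 0 < a) (hρ : ρ ∈ Ioo (1 / 2 : ℝ) 1) (h : phi0 a ρ = 0) :
    Real.log a = logParam (2 * ρ - 1) := by
  have hu : 0 < 2 * ρ - 1 := by linarith [hρ.1]
  have hu1 : |2 * ρ - 1| < 1 := by rw [abs_of_pos hu]; linarith [hρ.2]
  have hfe : completedRiemannZeta (2 * ρ) = completedRiemannZeta ((-(2 * ρ - 1) : ℝ) : ℂ) := by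
    rw [← completedRiemannZeta_one_sub]
    push_cast
    ring_nf
  have hne (x : ℝ) (h0 : x ≠ 0) (h1 : |x| < 1) : ‖completedRiemannZeta x‖ ≠ 0 :=
    norm_ne_zero_iff.2 (completedRiemannZeta_ne_zero_of_norm_lt_one (by exact_mod_cast h0)
      (by simpa using h1))
  have h2 := congrArg norm (eq_neg_of_add_eq_zero_left h)
  rw [norm_neg, norm_mul, norm_mul, norm_cpow_eq_rpow_re_of_pos ha, norm_cpow_eq_rpow_re_of_pos ha,
    hfe, show (2 * ρ - 1 : ℂ) = ((2 * ρ - 1 : ℝ) : ℂ) by push_cast; rfl] at h2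
  have h3 := congrArg Real.log h2
  rw [Real.log_mul (hne _ (by linarith) (by rwa [abs_neg])) (by positivity),
    Real.log_mul (hne _ hu.ne' hu1) (by positivity), Real.log_rpow ha, Real.log_rpow ha] at h3
  simp only [sub_re, ofReal_re, one_re] at h3
  rw [logParam, eq_div_iff hu.ne']
  linarith

lemma aStar_pos : 0 < aStar := by
  unfold aStar
  positivity

/-- The off-line real zero `ρ_a ∈ (1/2,1)` of `φ₀(a,·)` is a nondecreasing function of
`a > a*`, and it tends to `1` as `a → ∞`. -/
theorem phi0_real_zero_monotone_tendsto_one :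
    (∀ a a' : ℝ, aStar < a → a ≤ a' → ∀ ρ ρ' : ℝ,
      ρ ∈ Set.Ioo (1 / 2 : ℝ) 1 → ρ' ∈ Set.Ioo (1 / 2 : ℝ) 1 →
      phi0 a ρ = 0 → phi0 a' ρ' = 0 → ρ ≤ ρ') ∧
    (∀ ε : ℝ, 0 < ε → ∃ A : ℝ, aStar < A ∧ ∀ a : ℝ, A < a →
      ∀ ρ : ℝ, ρ ∈ Set.Ioo (1 / 2 : ℝ) 1 → phi0 a ρ = 0 → 1 - ε < ρ) := by
  have mem {ρ : ℝ} (h : ρ ∈ Ioo (1 / 2 : ℝ) 1) : 2 * ρ - 1 ∈ Ioo (0 : ℝ) 1 :=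
    ⟨by linarith [h.1], by linarith [h.2]⟩
  constructor
  · intro a a' ha haa' ρ ρ' hρ hρ' h h'
    have ha0 := aStar_pos.trans ha
    have hlog := Real.log_le_log ha0 haa'
    rw [log_eq_logParam ha0 hρ h, log_eq_logParam (ha0.trans_le haa') hρ' h',
      strictMonoOn_logParam.le_iff_le (mem hρ) (mem hρ')] at hlog
    linarith
  · intro ε hε
    rcases le_or_gt (1 / 2) ε with hε' | hε'
    · exact ⟨aStar + 1, by linarith, fun a _ ρ hρ _ ↦ by linarith [hρ.1]⟩
    · have hσ : 1 - ε ∈ Ioo (1 / 2 : ℝ) 1 := ⟨by linarith, by linarith⟩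
      refine ⟨max (aStar + 1) (Real.exp (logParam (2 * (1 - ε) - 1))),
        lt_max_of_lt_left (by linarith), fun a ha ρ hρ h ↦ ?_⟩
      obtain ⟨ha1, ha2⟩ := max_lt_iff.1 ha
      have ha0 : 0 < a := by linarith [aStar_pos]
      rw [← Real.lt_log_iff_exp_lt ha0, log_eq_logParam ha0 hρ h,
        strictMonoOn_logParam.lt_iff_lt (mem hσ) (mem hρ)] at ha2
      linarith
end

section
/- The holomorphic extension c of s ↦ Λ(2s-1)/Λ(2s) to a neighborhood of s = 1/2 satisfies c′(1/2) = -2 log(4π e^{-γ}) = 2γ - 2 log(4π); equivalently, with ξ(s) := s(s-1)Λ(s) extended to an entire function, 2(1 + ξ′(0)/ξ(0)) = log(4π) - γ. -/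
open Complex Filter

/-- The entire function extending `s (s - 1) Λ(s)`. -/
noncomputable def entireXi (s : ℂ) : ℂ := s * (s - 1) * completedRiemannZeta₀ s + 1

lemma entireXi_zero : entireXi 0 = 1 := by simp [entireXi]

lemma entireXi_one : entireXi 1 = 1 := by simp [entireXi]

lemma entireXi_eq {s : ℂ} (h0 : s ≠ 0) (h1 : s ≠ 1) :
    entireXi s = s * (s - 1) * completedRiemannZeta s := by
  have h1' : 1 - s ≠ 0 := sub_ne_zero.mpr h1.symm
  rw [entireXi, completedRiemannZeta_eq]
  field_simp
  ring

lemma completedRiemannZeta_eq_entireXi_div {s : ℂ} (h0 : s ≠ 0) (h1 : s ≠ 1) :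
    completedRiemannZeta s = entireXi s / (s * (s - 1)) := by
  rw [entireXi_eq h0 h1, mul_div_cancel_left₀ _ (mul_ne_zero h0 (sub_ne_zero.mpr h1))]

lemma hasDerivAt_entireXi (s : ℂ) :
    HasDerivAt entireXi
      ((2 * s - 1) * completedRiemannZeta₀ s + s * (s - 1) * deriv completedRiemannZeta₀ s) s := by
  have h := (((hasDerivAt_id s).mul ((hasDerivAt_id s).sub_const 1)).mul
    (differentiable_completedZeta₀ s).hasDerivAt).add_const 1
  refine h.congr_deriv ?_
  simp only [Pi.mul_apply, id]
  ring

lemma differentiable_entireXi : Differentiable ℂ entireXi :=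
  fun s ↦ (hasDerivAt_entireXi s).differentiableAt

lemma hasDerivAt_entireXi_zero : HasDerivAt entireXi (-completedRiemannZeta₀ 0) 0 := by
  simpa using hasDerivAt_entireXi 0

lemma hasDerivAt_entireXi_one : HasDerivAt entireXi (completedRiemannZeta₀ 0) 1 := by
  have h : completedRiemannZeta₀ 1 = completedRiemannZeta₀ 0 := by
    simpa using completedRiemannZeta₀_one_sub 0
  refine (hasDerivAt_entireXi 1).congr_deriv ?_
  rw [h]
  ring

lemma completedRiemannZeta₀_zero_eq_ofReal :
    completedRiemannZeta₀ 0 =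
      (((Real.eulerMascheroniConstant - Real.log (4 * Real.pi)) / 2 + 1 : ℝ) : ℂ) := by
  rw [completedRiemannZeta₀_zero]
  push_cast [ofReal_log (by positivity : 0 ≤ 4 * Real.pi)]
  rfl

/-- The meromorphic function extending `s ↦ Λ(2s-1)/Λ(2s)` holomorphically to `s = 1/2`. -/
noncomputable def scatteringFunction (s : ℂ) : ℂ :=
  2 * s * entireXi (2 * s - 1) / ((2 * s - 2) * entireXi (2 * s))

lemma scatteringFunction_eq {s : ℂ} (h0 : s ≠ 0) (h1 : s ≠ 1) (h : s ≠ 1 / 2) :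
    scatteringFunction s =
      completedRiemannZeta (2 * s - 1) / completedRiemannZeta (2 * s) := by
  have h2 : 2 * s - 1 ≠ 0 := fun e ↦ h (by linear_combination e / 2)
  have h3 : 2 * s - 1 ≠ 1 := fun e ↦ h1 (by linear_combination e / 2)
  have h4 : 2 * s ≠ 0 := mul_ne_zero two_ne_zero h0
  have h5 : 2 * s - 2 ≠ 0 := fun e ↦ h1 (by linear_combination e / 2)
  rw [completedRiemannZeta_eq_entireXi_div h2 h3,
    completedRiemannZeta_eq_entireXi_div h4 (sub_ne_zero.mp h2), scatteringFunction,
    show 2 * s - 1 - 1 = 2 * s - 2 by ring]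
  rcases eq_or_ne (entireXi (2 * s)) 0 with hE | hE
  · simp [hE]
  · field_simp

lemma hasDerivAt_scatteringFunction_half :
    HasDerivAt scatteringFunction (4 * completedRiemannZeta₀ 0 - 4) (1 / 2) := by
  have hl : HasDerivAt (fun s : ℂ ↦ 2 * s) 2 (1 / 2) := by
    simpa using (hasDerivAt_id (1 / 2 : ℂ)).const_mul 2
  have hX0 : HasDerivAt (fun s ↦ entireXi (2 * s - 1)) (-completedRiemannZeta₀ 0 * 2) (1 / 2) :=
    HasDerivAt.comp (1 / 2 : ℂ) (h₂ := entireXi)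
      (by simpa using hasDerivAt_entireXi_zero) (hl.sub_const 1)
  have hX1 : HasDerivAt (fun s ↦ entireXi (2 * s)) (completedRiemannZeta₀ 0 * 2) (1 / 2) :=
    HasDerivAt.comp (1 / 2 : ℂ) (h₂ := entireXi)
      (by simpa using hasDerivAt_entireXi_one) hl
  have h := (hl.mul hX0).div ((hl.sub_const 2).mul hX1)
    (by norm_num [entireXi_one])
  refine h.congr_deriv ?_
  norm_num [entireXi_zero, entireXi_one]
  ring

/-- The holomorphic extension `c` of the scattering function `s ↦ Λ(2s-1)/Λ(2s)` to a
neighborhood of `s = 1/2` satisfies `c′(1/2) = -2 log(4π e^{-γ}) = 2γ - 2 log(4π)`;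
equivalently, any entire extension `ξ` of `s(s-1)Λ(s)` satisfies
`2(1 + ξ′(0)/ξ(0)) = log(4π) - γ`, where `γ` is the Euler–Mascheroni constant. -/
theorem scattering_function_deriv_at_half :
    (∃ (c : ℂ → ℂ) (U : Set ℂ), IsOpen U ∧ (1 / 2 : ℂ) ∈ U ∧ DifferentiableOn ℂ c U ∧
      (∀ s ∈ U, s ≠ 1 / 2 →
        c s = completedRiemannZeta (2 * s - 1) / completedRiemannZeta (2 * s)) ∧
      deriv c (1 / 2) =
        (-2 * Real.log (4 * Real.pi * Real.exp (-Real.eulerMascheroniConstant)) : ℝ) ∧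
      deriv c (1 / 2) =
        (2 * Real.eulerMascheroniConstant - 2 * Real.log (4 * Real.pi) : ℝ)) ∧
    (∀ ξ : ℂ → ℂ, Differentiable ℂ ξ →
      (∀ s : ℂ, s ≠ 0 → s ≠ 1 → ξ s = s * (s - 1) * completedRiemannZeta s) →
      2 * (1 + deriv ξ 0 / ξ 0) =
        ((Real.log (4 * Real.pi) - Real.eulerMascheroniConstant : ℝ) : ℂ)) := by
  constructor
  · have hc : deriv scatteringFunction (1 / 2) =
        (2 * Real.eulerMascheroniConstant - 2 * Real.log (4 * Real.pi) : ℝ) := by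
      rw [hasDerivAt_scatteringFunction_half.deriv, completedRiemannZeta₀_zero_eq_ofReal]
      push_cast
      ring
    have hX : Differentiable ℂ (fun s ↦ entireXi (2 * s)) :=
      differentiable_entireXi.comp (by fun_prop)
    have hX' : Differentiable ℂ (fun s ↦ entireXi (2 * s - 1)) :=
      differentiable_entireXi.comp (by fun_prop)
    have hD : Differentiable ℂ (fun s ↦ (2 * s - 2) * entireXi (2 * s)) := by fun_prop
    refine ⟨scatteringFunction, {s | s ≠ 0} ∩ {s | (2 * s - 2) * entireXi (2 * s) ≠ 0},
      isOpen_ne.inter (isOpen_ne_fun hD.continuous continuous_const), ?_, ?_, ?_, ?_, hc⟩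
    · constructor <;> norm_num [entireXi_one]
    · intro s hs
      exact (DifferentiableAt.div (by fun_prop) hD.differentiableAt hs.2).differentiableWithinAt
    · rintro s ⟨h0, hs⟩ h
      refine scatteringFunction_eq h0 ?_ h
      rintro rfl
      simp at hs
    · rw [hc, Real.log_mul (by positivity) (Real.exp_ne_zero _), Real.log_exp]
      congr 1
      ring
  · intro ξ hξ h
    have hev : ξ =ᶠ[nhdsWithin 0 {0}ᶜ] entireXi := by
      filter_upwards [self_mem_nhdsWithin,
        nhdsWithin_le_nhds (isOpen_ne.mem_nhds (zero_ne_one' ℂ))] with s h0 h1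
      rw [h s h0 h1, entireXi_eq h0 h1]
    have hev' : ξ =ᶠ[nhds 0] entireXi :=
      (hξ.continuous.continuousAt.eventuallyEq_nhds_iff_eventuallyEq_nhdsNE
        differentiable_entireXi.continuous.continuousAt).mp hev
    rw [hev'.deriv_eq, hev'.eq_of_nhds, hasDerivAt_entireXi_zero.deriv, entireXi_zero,
      completedRiemannZeta₀_zero_eq_ofReal]
    push_cast
    ring
end
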